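/- Let T ∈ S^4 C^5 with a non-redundant decomposition A of 13 points in P^4 satisfying: k_1(A) = 5, k_2(A) = 13, and every subset of A of length ≤ 11 has finite quadric base locus of length ≤ 16. If T has a second decomposition B of length s ≤ 13 with A ∩ B ≠ ∅, then s = 13 and A ∩ B is a singleton {P}; moreover there is a form T' in the span of v_4(A∖{P}) of rank 12 with two disjoint decompositions of length 12, namely A∖{P} and B∖{P}. -/

import Mathlib

open MvPolynomial

noncomputable section

/-- Projective n-space over ℂ. -/
abbrev Pn (n : ℕ) := Projectivization ℂ (Fin (n + 1) → ℂ)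

/-- Evaluation of a polynomial at a vector, as a linear map. -/
noncomputable def evalAt {n : ℕ} (v : Fin (n + 1) → ℂ) :
    MvPolynomial (Fin (n + 1)) ℂ →ₗ[ℂ] ℂ :=
  (MvPolynomial.aeval v).toLinearMap

/-- The degree-`j` homogeneous piece of the polynomial ring `R = ℂ[x_0,…,x_n]`. -/
abbrev Rdeg (n j : ℕ) : Submodule ℂ (MvPolynomial (Fin (n + 1)) ℂ) :=
  MvPolynomial.homogeneousSubmodule (Fin (n + 1)) ℂ j

/-- Evaluation of degree-`j` forms at the points of a finite set `Z ⊂ ℙⁿ`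
(using chosen representatives; its rank does not depend on the choice). -/
noncomputable def evalMap {n : ℕ} (Z : Finset (Pn n)) (j : ℕ) :
    (Rdeg n j) →ₗ[ℂ] (Z → ℂ) :=
  (LinearMap.pi fun z : Z => evalAt (z : Pn n).rep).comp (Rdeg n j).subtype

/-- Hilbert function of a finite set of points `Z ⊂ ℙⁿ`. -/
noncomputable def hilb {n : ℕ} (Z : Finset (Pn n)) (j : ℕ) : ℕ :=
  Module.finrank ℂ (LinearMap.range (evalMap Z j))

/-- First difference of the Hilbert function (the `h`-vector entries). -/
noncomputable def Dh {n : ℕ} (Z : Finset (Pn n)) : ℕ → ℕ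
  | 0 => hilb Z 0
  | (j + 1) => hilb Z (j + 1) - hilb Z j

/-- The Cayley–Bacharach property `CB(i)`: every degree-`i` form vanishing on
`Z ∖ {P}` also vanishes at `P`, for every `P ∈ Z`. -/
def CB {n : ℕ} (Z : Finset (Pn n)) (i : ℕ) : Prop :=
  ∀ P ∈ Z, ∀ f ∈ Rdeg n i,
    (∀ Q ∈ Z, Q ≠ P → evalAt (Q : Pn n).rep f = 0) → evalAt P.rep f = 0

/-- The `d`-th power of the linear form corresponding to a point `P ∈ ℙⁿ`,
i.e. the image of `P` under the degree-`d` Veronese map (rep-scaled). -/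
noncomputable def powForm (n d : ℕ) (P : Pn n) : MvPolynomial (Fin (n + 1)) ℂ :=
  (∑ i, P.rep i • MvPolynomial.X i) ^ d

/-- `A` computes (is a decomposition of) the degree-`d` form `T`:
`T` lies in the span of the `d`-th powers of the linear forms given by `A`. -/
def computes (n d : ℕ) (A : Finset (Pn n)) (T : MvPolynomial (Fin (n + 1)) ℂ) : Prop :=
  T ∈ Submodule.span ℂ (powForm n d '' (A : Set (Pn n)))

/-- `A` is a non-redundant decomposition of `T`. -/
def nonRedundant (n d : ℕ) (A : Finset (Pn n)) (T : MvPolynomial (Fin (n + 1)) ℂ) : Prop :=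
  computes n d A T ∧ ∀ A' : Finset (Pn n), A' ⊂ A → ¬ computes n d A' T

/-- The `d`-th Kruskal rank of `A` is `≥ k`: all subsets of `v_d(A)` of
cardinality at most `k` are linearly independent. -/
def kruskalGe (n d : ℕ) (A : Finset (Pn n)) (k : ℕ) : Prop :=
  ∀ S : Finset (Pn n), S ⊆ A → S.card ≤ k →
    LinearIndependent ℂ (fun P : S => powForm n d P.1)

/-- Quadrics through `A`. -/
def quadricsThrough (n : ℕ) (A : Finset (Pn n)) : Set (MvPolynomial (Fin (n + 1)) ℂ) :=
  {f | f ∈ Rdeg n 2 ∧ ∀ P ∈ A, evalAt P.rep f = 0}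

/-- Base locus of the linear system of quadric hypersurfaces through `A`. -/
def baseLocusQ (n : ℕ) (A : Finset (Pn n)) : Set (Pn n) :=
  {Q | ∀ f ∈ quadricsThrough n A, evalAt Q.rep f = 0}

/-- Waring rank of a form `T`. -/
noncomputable def waringRank (n d : ℕ) (T : MvPolynomial (Fin (n + 1)) ℂ) : ℕ :=
  sInf {r | ∃ B : Finset (Pn n), B.card = r ∧ computes n d B T}

/-- Degree-`d` graded piece of the homogeneous ideal of `Z`. -/
noncomputable def idealDeg (n : ℕ) (Z : Finset (Pn n)) (d : ℕ) :
    Submodule ℂ (MvPolynomial (Fin (n + 1)) ℂ) :=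
  Rdeg n d ⊓ ⨅ P ∈ Z, LinearMap.ker (evalAt (P : Pn n).rep)

end

open scoped Classical

lemma coeff_powForm (n d : ℕ) (P : Pn n) (m : Fin (n+1) →₀ ℕ) :
    coeff m (powForm n d P) = if m.degree = d then
      (m.multinomial : ℂ) * ∏ i, P.rep i ^ m i else 0 := by
  unfold powForm
  rw [coeff_linearCombination_X_pow_of_fintype]
  simp only [Finsupp.degree_eq_sum, Finsupp.sum_fintype, Finsupp.prod_fintype, pow_zero, implies_true]

lemma evalAt_eq {n : ℕ} (v : Fin (n+1) → ℂ) (f : MvPolynomial (Fin (n+1)) ℂ) :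
    evalAt v f = ∑ m ∈ f.support, coeff m f * ∏ i, v i ^ m i := by
  simp [evalAt, aeval_def, eval₂_eq']

lemma evalAt_mul {n : ℕ} (v : Fin (n+1) → ℂ) (f g : MvPolynomial (Fin (n+1)) ℂ) :
    evalAt v (f * g) = evalAt v f * evalAt v g := by
  simp [evalAt]

/-- dual functional -/
noncomputable def dualF {n : ℕ} (f : MvPolynomial (Fin (n+1)) ℂ) :
    MvPolynomial (Fin (n+1)) ℂ →ₗ[ℂ] ℂ :=
  ∑ m ∈ f.support, (coeff m f * (m.multinomial : ℂ)⁻¹) • MvPolynomial.lcoeff ℂ m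

lemma multinomial_ne {n : ℕ} (m : Fin (n+1) →₀ ℕ) : (m.multinomial : ℂ) ≠ 0 := by
  rw [Finsupp.multinomial_eq]
  exact_mod_cast (Nat.multinomial_pos _ _).ne'

lemma dualF_powForm {n d : ℕ} (f : MvPolynomial (Fin (n+1)) ℂ) (hf : f ∈ Rdeg n d) (P : Pn n) :
    dualF f (powForm n d P) = evalAt P.rep f := by
  rw [evalAt_eq]
  simp only [dualF, LinearMap.sum_apply, LinearMap.smul_apply, lcoeff_apply, smul_eq_mul]
  refine Finset.sum_congr rfl fun m hm => ?_
  have hd : m.degree = d := by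
    have := (mem_homogeneousSubmodule _ _).1 hf (mem_support_iff.1 hm)
    rw [Finsupp.degree_eq_weight_one]; exact this
  rw [coeff_powForm, if_pos hd]
  have := multinomial_ne m
  field_simp

lemma powSum_eq_zero {n d : ℕ} (S : Finset (Pn n)) (c : Pn n → ℂ)
    (h : ∀ f ∈ Rdeg n d, ∑ P ∈ S, c P * evalAt P.rep f = 0) :
    ∑ P ∈ S, c P • powForm n d P = 0 := by
  ext m
  simp only [coeff_sum, coeff_smul, coeff_powForm, coeff_zero, smul_eq_mul]
  by_cases hd : m.degree = d
  · simp only [hd, if_true]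
    have h1 := h (monomial m 1) ((mem_homogeneousSubmodule _ _).2 (isHomogeneous_monomial _ hd))
    have h2 : ∀ P : Pn n, evalAt P.rep (monomial m 1) = ∏ i, P.rep i ^ m i := by
      intro P
      simp [evalAt, aeval_monomial, Finsupp.prod_fintype]
    simp only [h2] at h1
    rw [← mul_zero (m.multinomial : ℂ), ← h1, Finset.mul_sum]
    exact Finset.sum_congr rfl fun P _ => by ring
  · simp [hd]

lemma mem_span_image_fin {α M : Type*} [AddCommGroup M] [Module ℂ M] (v : α → M) (S : Finset α)
    (x : M) (h : x ∈ Submodule.span ℂ (v '' (S : Set α))) :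
    ∃ c : α → ℂ, ∑ i ∈ S, c i • v i = x := by
  obtain ⟨c, hc⟩ := (Submodule.mem_span_image_finset_iff_exists_fun ℂ).1 h
  refine ⟨fun P => if h : P ∈ S then c ⟨P, h⟩ else 0, ?_⟩
  rw [← hc, ← Finset.sum_coe_sort S]
  exact Finset.sum_congr rfl fun P hP => by simp

lemma computes_iff {n d : ℕ} (A : Finset (Pn n)) (T : MvPolynomial (Fin (n+1)) ℂ) :
    computes n d A T ↔ ∃ c : Pn n → ℂ, T = ∑ P ∈ A, c P • powForm n d P := by
  unfold computes
  constructor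
  · intro h
    obtain ⟨c, hc⟩ := mem_span_image_fin _ _ _ h
    exact ⟨c, hc.symm⟩
  · rintro ⟨c, rfl⟩
    exact Submodule.sum_mem _ fun P hP => Submodule.smul_mem _ _
      (Submodule.subset_span ⟨P, hP, rfl⟩)

lemma evalMap_surj {n d : ℕ} (S : Finset (Pn n))
    (h : LinearIndependent ℂ (fun P : S => powForm n d P.1)) :
    Function.Surjective (evalMap S d) := by
  rw [← LinearMap.range_eq_top]
  by_contra hne
  obtain ⟨φ, hφ, hle⟩ := Submodule.exists_le_ker_of_lt_top _ (lt_top_iff_ne_top.2 hne)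
  apply hφ
  set c : Pn n → ℂ := fun P => if h : P ∈ S then φ (Pi.single ⟨P, h⟩ 1) else 0 with hc
  have key : ∀ w : S → ℂ, φ w = ∑ P : S, c P * w P := by
    intro w
    conv_lhs => rw [← Finset.univ_sum_single w]
    rw [map_sum]
    refine Finset.sum_congr rfl fun P _ => ?_
    have : Pi.single P (w P) = w P • (Pi.single P (1:ℂ) : S → ℂ) := by
      rw [← Pi.single_smul]; simp
    rw [this, map_smul, hc]
    simp [mul_comm]
  have h0 : ∑ P ∈ S, c P • powForm n d P = 0 := by
    apply powSum_eq_zero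
    intro f hf
    have := hle (LinearMap.mem_range_self (evalMap S d) ⟨f, hf⟩)
    rw [LinearMap.mem_ker, key] at this
    rw [← Finset.sum_coe_sort S]
    exact this
  rw [← Finset.sum_coe_sort S] at h0
  have hz := Fintype.linearIndependent_iff.1 h _ h0
  ext1 w
  ext
  rw [LinearMap.comp_apply, key]
  simp [hz]

lemma evalMap_eq_zero {n d : ℕ} {S : Finset (Pn n)} {f : Rdeg n d} :
    evalMap S d f = 0 ↔ ∀ P ∈ S, evalAt P.rep f.1 = 0 := by
  constructor
  · intro h P hP
    exact congrFun h ⟨P, hP⟩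
  · intro h
    ext ⟨P, hP⟩
    exact h P hP

lemma mainL {n : ℕ} (S D : Finset (Pn n)) (a : Pn n → ℂ) (ha : ∀ P ∈ S, a P ≠ 0)
    (hS : LinearIndependent ℂ (fun P : S => powForm n 2 P.1))
    (hD : computes n 4 D (∑ P ∈ S, a P • powForm n 4 P)) :
    S.card ≤ D.card ∧ (S.card = D.card → ∀ f ∈ Rdeg n 2,
      (∀ P ∈ S, evalAt P.rep f = 0) → ∀ P ∈ D, evalAt P.rep f = 0) := by
  obtain ⟨b, hb⟩ := (computes_iff _ _).1 hD
  have hev : ∀ f ∈ Rdeg n 4, ∑ P ∈ S, a P * evalAt P.rep f = ∑ P ∈ D, b P * evalAt P.rep f := by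
    intro f hf
    have := congrArg (dualF f) hb
    simpa [map_sum, dualF_powForm f hf] using this
  have hker : ∀ q : Rdeg n 2, evalMap D 2 q = 0 → evalMap S 2 q = 0 := by
    intro q hq
    rw [evalMap_eq_zero] at hq ⊢
    have h0 : ∑ P ∈ S, (a P * evalAt P.rep q.1) • powForm n 2 P = 0 := by
      apply powSum_eq_zero
      intro g hg
      have h1 := hev (q.1 * g) (by
        have := ((mem_homogeneousSubmodule _ _).1 q.2).mul ((mem_homogeneousSubmodule _ _).1 hg)
        exact (mem_homogeneousSubmodule _ _).2 this)
      rw [Finset.sum_eq_zero (s := D) (fun P hP => by rw [evalAt_mul, hq P hP]; ring)] at h1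
      rw [← h1]
      exact Finset.sum_congr rfl fun P _ => by rw [evalAt_mul]; ring
    rw [← Finset.sum_coe_sort S] at h0
    have hz := Fintype.linearIndependent_iff.1 hS _ h0
    intro P hP
    exact (mul_eq_zero.1 (hz ⟨P, hP⟩)).resolve_left (ha P hP)
  obtain ⟨σ, hσ⟩ := LinearMap.exists_rightInverse_of_surjective (evalMap S 2)
    (LinearMap.range_eq_top.2 (evalMap_surj S hS))
  have hσ' : ∀ w, evalMap S 2 (σ w) = w := fun w => LinearMap.congr_fun hσ w
  have hinj : Function.Injective ((evalMap D 2).comp σ) := by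
    rw [injective_iff_map_eq_zero]
    intro w hw
    rw [← hσ' w]; exact hker _ hw
  have hle := LinearMap.finrank_le_finrank_of_injective hinj
  simp only [Module.finrank_fintype_fun_eq_card, Fintype.card_coe] at hle
  refine ⟨hle, fun heq f hf hfS => ?_⟩
  have hsurj : Function.Surjective ((evalMap D 2).comp σ) :=
    (LinearMap.injective_iff_surjective_of_finrank_eq_finrank (by simp [heq])).1 hinj
  have hfS' : evalMap S 2 ⟨f, hf⟩ = 0 := evalMap_eq_zero.2 hfS
  obtain ⟨w, hw⟩ := hsurj (evalMap D 2 ⟨f, hf⟩)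
  have h1 := hker (⟨f, hf⟩ - σ w) (by rw [map_sub, ← hw]; simp)
  rw [map_sub, hfS', hσ', zero_sub, neg_eq_zero] at h1
  subst h1
  rw [map_zero] at hw
  exact evalMap_eq_zero.1 hw.symm

/-- product of linear forms -/
lemma split_cond (G U W : Finset (Pn 4)) (hG : G ⊆ U ∪ W) (Q : Pn 4) (hQ : Q ∈ baseLocusQ 4 G) :
    Q.rep ∈ Submodule.span ℂ (Projectivization.rep '' (U : Set (Pn 4))) ∨
    Q.rep ∈ Submodule.span ℂ (Projectivization.rep '' (W : Set (Pn 4))) := by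
  by_contra! hcon
  obtain ⟨φ, hφ, hφU⟩ := Submodule.exists_le_ker_of_notMem hcon.1
  obtain ⟨ψ, hψ, hψW⟩ := Submodule.exists_le_ker_of_notMem hcon.2
  let lin : ((Fin 5 → ℂ) →ₗ[ℂ] ℂ) → MvPolynomial (Fin 5) ℂ := fun φ =>
    ∑ i, C (φ (Pi.single i 1)) * X i
  have hlin : ∀ φ, (lin φ).IsHomogeneous 1 := fun φ =>
    IsHomogeneous.sum _ _ _ fun i _ => by
      simpa using (isHomogeneous_C (Fin 5) (φ (Pi.single i 1))).mul (isHomogeneous_X ℂ i)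
  have hev : ∀ φ (v : Fin 5 → ℂ), evalAt (n := 4) v (lin φ) = φ v := by
    intro φ v
    conv_rhs => rw [← Finset.univ_sum_single v, map_sum]
    simp only [evalAt, lin, AlgHom.toLinearMap_apply, map_sum, map_mul, aeval_C, aeval_X]
    refine Finset.sum_congr rfl fun i _ => ?_
    have : Pi.single i (v i) = v i • (Pi.single i (1:ℂ) : Fin 5 → ℂ) := by
      rw [← Pi.single_smul]; simp
    rw [this, map_smul]
    simp [mul_comm]
  have := hQ (lin φ * lin ψ) ⟨(mem_homogeneousSubmodule _ _).2 ((hlin φ).mul (hlin ψ)), by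
    intro P hP
    rw [evalAt_mul, hev, hev]
    rcases Finset.mem_union.1 (hG hP) with h | h
    · have h1 : φ P.rep = 0 := hφU (Submodule.subset_span ⟨P, h, rfl⟩)
      rw [h1, zero_mul]
    · have h1 : ψ P.rep = 0 := hψW (Submodule.subset_span ⟨P, h, rfl⟩)
      rw [h1, mul_zero]⟩
  rw [evalAt_mul, hev, hev] at this
  exact mul_ne_zero hφ hψ this

lemma rep_indep (A S : Finset (Pn 4)) (hk1 : kruskalGe 4 1 A 5) (hS : S ⊆ A) (hc : S.card ≤ 5) :
    LinearIndepOn ℂ (Projectivization.rep : Pn 4 → _) (S : Set (Pn 4)) := by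
  have h := hk1 S hS hc
  let L : (Fin 5 → ℂ) →ₗ[ℂ] MvPolynomial (Fin 5) ℂ :=
    Fintype.linearCombination ℂ (fun i => (X i : MvPolynomial (Fin 5) ℂ))
  refine LinearIndependent.of_comp L ?_
  have he : (L ∘ fun P : (S : Set (Pn 4)) => (P : Pn 4).rep) =
      fun P : S => powForm 4 1 P.1 := by
    funext P
    simp [L, powForm, Fintype.linearCombination_apply]
  exact he ▸ h

lemma notMem_span (A : Finset (Pn 4)) (hk1 : kruskalGe 4 1 A 5) (W : Finset (Pn 4)) (p : Pn 4)
    (hW : insert p W ⊆ A) (hc : W.card ≤ 4) (hp : p ∉ W) :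
    p.rep ∉ Submodule.span ℂ (Projectivization.rep '' (W : Set (Pn 4))) := by
  have h := rep_indep A (insert p W) hk1 hW ((Finset.card_insert_le _ _).trans (by omega))
  rw [Finset.coe_insert, linearIndepOn_insert (by simpa using hp)] at h
  exact h.2

lemma base8 (A G : Finset (Pn 4)) (hk1 : kruskalGe 4 1 A 5) (hGA : G ⊆ A) (hG : G.card = 8)
    (Q : Pn 4) (hQ : Q ∈ baseLocusQ 4 G) : Q ∈ G := by
  let sp : Finset (Pn 4) → Submodule ℂ (Fin 5 → ℂ) := fun U =>
    Submodule.span ℂ (Projectivization.rep '' (U : Set (Pn 4)))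
  -- a small subset whose span has Q
  have hex : ∃ k, ∃ M ⊆ G, M.card = k ∧ Q.rep ∈ sp M := by
    obtain ⟨U, hU, hUc⟩ := Finset.exists_subset_card_eq (show 4 ≤ G.card by omega)
    rcases split_cond G U (G \ U) (by simp) Q hQ with h | h
    · exact ⟨_, U, hU, rfl, h⟩
    · exact ⟨_, G \ U, Finset.sdiff_subset, rfl, h⟩
  obtain ⟨M, hMG, hMc, hQM⟩ := Nat.find_spec hex
  have hmin : ∀ N ⊆ G, Q.rep ∈ sp N → M.card ≤ N.card := fun N hN hQN => by
    rw [hMc]; exact Nat.find_min' hex ⟨N, hN, rfl, hQN⟩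
  have hM4 : M.card ≤ 4 := by
    obtain ⟨U, hU, hUc⟩ := Finset.exists_subset_card_eq (show 4 ≤ G.card by omega)
    have hUc' : (G \ U).card = 4 := by rw [Finset.card_sdiff_of_subset hU]; omega
    rcases split_cond G U (G \ U) (by simp) Q hQ with h | h
    · exact (hmin _ hU h).trans hUc.le
    · exact (hmin _ Finset.sdiff_subset h).trans hUc'.le
  have hMne : M.Nonempty := by
    rw [Finset.nonempty_iff_ne_empty]
    rintro rfl
    simp [sp, Q.rep_nonzero] at hQM
  obtain ⟨p, hp⟩ := hMne
  have hpG := hMG hp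
  have hN : Q.rep ∉ sp (M.erase p) := fun h => by
    have := hmin _ ((Finset.erase_subset _ _).trans hMG) h
    rw [Finset.card_erase_of_mem hp] at this
    have := Finset.card_pos.2 ⟨p, hp⟩
    omega
  have claim : ∀ S ⊆ G \ M, S.card = 3 → Q.rep ∈ sp (insert p S) := by
    intro S hS hSc
    have hpS : p ∉ S := fun h => (Finset.mem_sdiff.1 (hS h)).2 hp
    have hUG : insert p S ⊆ G := Finset.insert_subset hpG (hS.trans Finset.sdiff_subset)
    rcases split_cond G (insert p S) (G \ insert p S)
      (by rw [Finset.union_sdiff_self_eq_union]; exact Finset.subset_union_right) Q hQ with h | h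
    · exact h
    · exfalso
      have hNW : M.erase p ⊆ G \ insert p S := by
        intro x hx
        rw [Finset.mem_erase] at hx
        simp only [Finset.mem_sdiff, Finset.mem_insert, not_or]
        exact ⟨hMG hx.2, hx.1, fun h => (Finset.mem_sdiff.1 (hS h)).2 hx.2⟩
      refine notMem_span A hk1 (G \ insert p S) p ?_ ?_ (by simp) ?_
      · exact Finset.insert_subset (hGA hpG) (Finset.sdiff_subset.trans hGA)
      · rw [Finset.card_sdiff_of_subset hUG, Finset.card_insert_of_notMem hpS]; omega
      · have h2 : Q.rep ∈ Submodule.span ℂ (insert p.rep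
            (Projectivization.rep '' ((M.erase p : Finset _) : Set (Pn 4)))) := by
          rw [← Set.image_insert_eq, ← Finset.coe_insert, Finset.insert_erase hp]
          exact hQM
        have h3 := mem_span_insert_exchange h2 hN
        refine Submodule.span_le.2 ?_ h3
        rintro x (rfl | hx)
        · exact h
        · exact Submodule.subset_span (Set.image_mono (by exact_mod_cast hNW) hx)
  have hRc : 4 ≤ (G \ M).card := by rw [Finset.card_sdiff_of_subset hMG]; omega
  obtain ⟨R, hR, hRc⟩ := Finset.exists_subset_card_eq hRc
  have hpR : p ∉ R := fun h => (Finset.mem_sdiff.1 (hR h)).2 hp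
  have hIA : insert p R ⊆ A :=
    Finset.insert_subset (hGA hpG) ((hR.trans Finset.sdiff_subset).trans hGA)
  obtain ⟨r0, hr0⟩ : R.Nonempty := Finset.card_pos.1 (by omega)
  have hcl : ∀ r ∈ R, Q.rep ∈ sp (insert p (R.erase r)) := fun r hr =>
    claim _ ((Finset.erase_subset _ _).trans hR) (by rw [Finset.card_erase_of_mem hr]; omega)
  have hQI : Q.rep ∈ sp (insert p R) :=
    Submodule.span_mono (Set.image_mono (by
      exact_mod_cast Finset.insert_subset_insert p (Finset.erase_subset r0 R))) (hcl r0 hr0)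
  obtain ⟨c0, hc0⟩ := mem_span_image_fin _ _ _ hQI
  have hcr : ∀ r ∈ R, c0 r = 0 := by
    intro r hr
    by_contra hne
    have hrp : r ≠ p := fun h => hpR (h ▸ hr)
    have hI : insert r (insert p (R.erase r)) = insert p R := by
      rw [Finset.insert_comm, Finset.insert_erase hr]
    have hrn : r ∉ insert p (R.erase r) := by simp [hrp]
    refine notMem_span A hk1 (insert p (R.erase r)) r (hI ▸ hIA) ?_ hrn ?_
    · refine (Finset.card_insert_le _ _).trans ?_
      rw [Finset.card_erase_of_mem hr]; omega
    · rw [← hI, Finset.sum_insert hrn] at hc0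
      have h5 : c0 r • r.rep ∈ sp (insert p (R.erase r)) := by
        rw [eq_sub_of_add_eq hc0]
        exact Submodule.sub_mem _ (hcl r hr) (Submodule.sum_mem _ fun x hx =>
          Submodule.smul_mem _ _ (Submodule.subset_span ⟨x, hx, rfl⟩))
      exact (Submodule.smul_mem_iff _ hne).1 h5
  rw [Finset.sum_insert hpR, Finset.sum_eq_zero (s := R) (fun r hr => by rw [hcr r hr, zero_smul]),
    add_zero] at hc0
  have : Q = p := by
    rw [← Q.mk_rep, ← p.mk_rep]
    exact (Projectivization.mk_eq_mk_iff' _ _ _ _ _).2 ⟨_, hc0⟩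
  exact this ▸ hpG

lemma computes_hom {n d : ℕ} (A : Finset (Pn n)) (T : MvPolynomial (Fin (n+1)) ℂ)
    (h : computes n d A T) : T.IsHomogeneous d := by
  obtain ⟨c, rfl⟩ := (computes_iff _ _).1 h
  refine IsHomogeneous.sum _ _ _ fun P _ => ?_
  have : (powForm n d P).IsHomogeneous d := by
    have h1 : (∑ i, P.rep i • (X i : MvPolynomial (Fin (n+1)) ℂ)).IsHomogeneous 1 :=
      IsHomogeneous.sum _ _ _ fun i _ => by
        rw [smul_eq_C_mul]
        simpa using (isHomogeneous_C (Fin (n+1)) (P.rep i)).mul (isHomogeneous_X ℂ i)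
    simpa [powForm] using h1.pow d
  rw [smul_eq_C_mul]
  simpa using (isHomogeneous_C (Fin (n+1)) (c P)).mul this



/-- `A` of 13 points, non-redundant for the quartic `T`, with
`k₁(A)=5`, `k₂(A)=13` and every subset of length `≤ 11` having finite quadric base
locus of length `≤ 16`.  If `T` has a second (non-redundant) decomposition `B` of
length `≤ 13` meeting `A`, then `ℓ(B)=13`, `A ∩ B = {P}` is a singleton, and some
quartic `T'` in the span of `v₄(A∖{P})` has rank `12` and the two disjoint length-12
decompositions `A∖{P}` and `B∖{P}`. -/
theorem stmt19 (T : MvPolynomial (Fin 5) ℂ) (hT : T.IsHomogeneous 4)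
    (A : Finset (Pn 4)) (hA : A.card = 13) (hnr : nonRedundant 4 4 A T)
    (hk1 : kruskalGe 4 1 A 5) (hk2 : kruskalGe 4 2 A 13)
    (hiv : ∀ A' : Finset (Pn 4), A' ⊆ A → A'.card ≤ 11 →
      (baseLocusQ 4 A').Finite ∧ (baseLocusQ 4 A').ncard ≤ 16)
    (B : Finset (Pn 4)) (hBne : B ≠ A) (hBnr : nonRedundant 4 4 B T)
    (hBcard : B.card ≤ 13) (hint : (A ∩ B).Nonempty) :
    B.card = 13 ∧ ∃ P : Pn 4, A ∩ B = {P} ∧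
      ∃ T' : MvPolynomial (Fin 5) ℂ, T'.IsHomogeneous 4 ∧
        computes 4 4 (A.erase P) T' ∧ computes 4 4 (B.erase P) T' ∧
        waringRank 4 4 T' = 12 ∧ Disjoint (A.erase P) (B.erase P) ∧
        (A.erase P).card = 12 ∧ (B.erase P).card = 12 := by
  obtain ⟨a, ha⟩ := (computes_iff _ _).1 hnr.1
  obtain ⟨b, hb⟩ := (computes_iff _ _).1 hBnr.1
  have ha0 : ∀ P ∈ A, a P ≠ 0 := by
    intro P hP h0
    refine hnr.2 (A.erase P) (Finset.erase_ssubset hP) ((computes_iff _ _).2 ⟨a, ?_⟩)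
    rw [ha, ← Finset.add_sum_erase A _ hP, h0, zero_smul, zero_add]
  have hsub : ∀ S ⊆ A, LinearIndependent ℂ (fun P : S => powForm 4 2 P.1) := fun S hS =>
    hk2 S hS ((Finset.card_le_card hS).trans hA.le)
  have hBA : ¬ B ⊆ A := fun h =>
    hnr.2 B (lt_of_le_of_ne h hBne) hBnr.1
  obtain ⟨Q, hQB, hQA⟩ := Finset.not_subset.1 hBA
  set a' : Pn 4 → ℂ := fun P => if P ∈ B then a P - b P else a P with ha'
  set T' : MvPolynomial (Fin 5) ℂ := ∑ P ∈ B \ A, b P • powForm 4 4 P with hT'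
  have hT'A : T' = ∑ P ∈ A, a' P • powForm 4 4 P := by
    have h1 : ∑ P ∈ A, a' P • powForm 4 4 P =
        ∑ P ∈ A, a P • powForm 4 4 P - ∑ P ∈ B ∩ A, b P • powForm 4 4 P := by
      rw [Finset.inter_comm, ← Finset.filter_mem_eq_inter, Finset.sum_filter,
        ← Finset.sum_sub_distrib]
      refine Finset.sum_congr rfl fun P _ => ?_
      by_cases h : P ∈ B <;> simp [ha', h, sub_smul]
    rw [h1, ← ha, hb, ← Finset.sum_inter_add_sum_sdiff B A]
    rw [hT']; abel
  set A' := A.filter (fun P => a' P ≠ 0) with hA'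
  have hA'A : A' ⊆ A := Finset.filter_subset _ _
  have hT'A' : T' = ∑ P ∈ A', a' P • powForm 4 4 P := by
    rw [hT'A, hA', Finset.sum_filter]
    refine Finset.sum_congr rfl fun P _ => ?_
    by_cases h : a' P = 0 <;> simp [h]
  have hAB : A \ B ⊆ A' := by
    intro P hP
    rw [Finset.mem_sdiff] at hP
    rw [hA', Finset.mem_filter]
    refine ⟨hP.1, ?_⟩
    simp [ha', hP.2, ha0 P hP.1]
  have hcB : computes 4 4 (B \ A) T' := (computes_iff _ _).2 ⟨b, rfl⟩
  have hmain := mainL A' (B \ A) a' (fun P hP => (Finset.mem_filter.1 hP).2) (hsub A' hA'A)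
    (hT'A' ▸ hcB)
  have c1 := Finset.card_le_card hAB
  have c2 := Finset.card_sdiff_add_card_inter A B
  have c3 := Finset.card_sdiff_add_card_inter B A
  rw [Finset.inter_comm] at c3
  have c4 := hmain.1
  have c5 := hint.card_pos
  have hEq : A \ B = A' := Finset.eq_of_subset_of_card_le hAB (by omega)
  have hbase : ∀ R ∈ B \ A, R ∈ baseLocusQ 4 A' := fun R hR f hf =>
    hmain.2 (by omega) f hf.1 hf.2 R hR
  have hQbase := hbase Q (Finset.mem_sdiff.2 ⟨hQB, hQA⟩)
  have h9 : 9 ≤ A'.card := by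
    by_contra hlt
    obtain ⟨G, hAG, hGA, hGc⟩ := Finset.exists_subsuperset_card_eq hA'A
      (show A'.card ≤ 8 by omega) (by omega)
    exact hQA (hGA (base8 A G hk1 hGA hGc Q fun f hf =>
      hQbase f ⟨hf.1, fun P hP => hf.2 P (hAG hP)⟩))
  have h12 : A'.card = 12 := by
    by_contra hne
    obtain ⟨hfin, hcard⟩ := hiv A' hA'A (by omega)
    have hsubs : ((A' ∪ B \ A : Finset (Pn 4)) : Set (Pn 4)) ⊆ baseLocusQ 4 A' := by
      intro R hR
      rcases Finset.mem_union.1 (Finset.mem_coe.1 hR) with h | h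
      · exact fun f hf => hf.2 R h
      · exact hbase R h
    have h1 := Set.ncard_le_ncard hsubs hfin
    rw [Set.ncard_coe_finset, Finset.card_union_of_disjoint
      (Finset.disjoint_of_subset_left hA'A Finset.disjoint_sdiff)] at h1
    omega
  refine ⟨by omega, ?_⟩
  obtain ⟨P, hP⟩ := Finset.card_eq_one.1 (show (A ∩ B).card = 1 by omega)
  have hPm : P ∈ A ∩ B := by rw [hP]; simp
  have hPA := (Finset.mem_inter.1 hPm).1
  have hPB := (Finset.mem_inter.1 hPm).2
  have eA : A.erase P = A' := by
    rw [← hEq, ← Finset.sdiff_inter_self_left, hP, Finset.sdiff_singleton_eq_erase]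
  have eB : B.erase P = B \ A := by
    rw [← Finset.sdiff_inter_self_left, Finset.inter_comm, hP, Finset.sdiff_singleton_eq_erase]
  have hcA : computes 4 4 A' T' := (computes_iff _ _).2 ⟨a', hT'A'⟩
  refine ⟨P, hP, T', computes_hom _ _ hcB, ?_⟩
  rw [eA, eB]
  refine ⟨hcA, hcB, ?_, Finset.disjoint_of_subset_left hA'A Finset.disjoint_sdiff, h12, by omega⟩
  refine le_antisymm (Nat.sInf_le ⟨A', h12, hcA⟩) (le_csInf ⟨_, A', h12, hcA⟩ ?_)
  rintro r ⟨D, rfl, hD⟩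
  rw [← h12]
  exact (mainL A' D a' (fun P hP => (Finset.mem_filter.1 hP).2) (hsub A' hA'A) (hT'A' ▸ hD)).1
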